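/- Let f : ℝ^n → ℝ ∪ {+∞} be a proper convex lower semicontinuous function and let α > 0. Then the Fenchel conjugate f* is strongly convex with constant α with respect to the Euclidean norm ‖·‖₂ if and only if f is differentiable on ℝ^n and its gradient ∇f is Lipschitz continuous with constant 1/α with respect to ‖·‖₂. -/

import Mathlib

open scoped RealInnerProductSpace Matrix
noncomputable section

/-- `ℝ^k` with the Euclidean norm. -/
abbrev E (k : ℕ) := EuclideanSpace ℝ (Fin k)

/-- Strong convexity with constant `α` w.r.t. the Euclidean norm for extended-real-valued
functions (restricted to points of the domain, i.e. where the function is finite). -/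
def StrongConvexOnE {k : ℕ} (C : Set (E k)) (α : ℝ) (f : E k → EReal) : Prop :=
  ∀ ⦃x⦄, x ∈ C → f x ≠ ⊤ → f x ≠ ⊥ → ∀ ⦃y⦄, y ∈ C → f y ≠ ⊤ → f y ≠ ⊥ →
    ∀ t ∈ Set.Icc (0:ℝ) 1,
      f (t • x + (1 - t) • y) ≤
        ((t * (f x).toReal + (1 - t) * (f y).toReal
            - α * t * (1 - t) / 2 * ‖y - x‖ ^ 2 : ℝ) : EReal)

/-- Convexity for extended-real-valued functions. -/
def EConvexOn {k : ℕ} (f : E k → EReal) : Prop :=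
  ∀ x y : E k, ∀ t ∈ Set.Ioo (0:ℝ) 1,
    f (t • x + (1 - t) • y) ≤ (t : EReal) * f x + ((1 - t : ℝ) : EReal) * f y

/-- The Fenchel conjugate `f*(x*) = sup_x (⟨x*, x⟩ − f(x))`. -/
def fenchelConj {k : ℕ} (f : E k → EReal) (y : E k) : EReal :=
  ⨆ x : E k, ((⟪y, x⟫ : ℝ) : EReal) - f x

/-- `x ↦ ⟪p, x⟫ - b` is an affine minorant of `f`. -/
def AffMin {k : ℕ} (f : E k → EReal) (p : E k) (b : ℝ) : Prop :=
  ∀ (x : E k) (r : ℝ), f x ≤ (r : EReal) → ⟪p, x⟫ - b ≤ r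

lemma conj_le_iff {k : ℕ} {f : E k → EReal} (hbot : ∀ x, f x ≠ ⊥) (p : E k) (b : ℝ) :
    fenchelConj f p ≤ (b : EReal) ↔ AffMin f p b := by
  unfold fenchelConj AffMin
  rw [iSup_le_iff]
  refine forall_congr' fun x => ?_
  rcases h : f x with _ | _ | v
  · exact absurd h (hbot x)
  · constructor
    · intro _ r hr
      exact absurd (top_le_iff.1 hr) (EReal.coe_ne_top r)
    · intro _
      change ((⟪p, x⟫ : ℝ) : EReal) - ⊤ ≤ _
      simp
  · change ((⟪p, x⟫ : ℝ) : EReal) - ((v : ℝ) : EReal) ≤ _ ↔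
      ∀ r : ℝ, ((v : ℝ) : EReal) ≤ _ → _
    rw [← EReal.coe_sub, EReal.coe_le_coe_iff]
    constructor
    · intro h1 r hr
      rw [EReal.coe_le_coe_iff] at hr
      linarith
    · intro h1
      have := h1 v le_rfl
      linarith

lemma conj_ne_bot {k : ℕ} {f : E k → EReal} (hproper : ∃ x, f x ≠ ⊤) (hbot : ∀ x, f x ≠ ⊥)
    (p : E k) : fenchelConj f p ≠ ⊥ := by
  obtain ⟨x, hx⟩ := hproper
  have h1 : ((⟪p, x⟫ : ℝ) : EReal) - f x ≤ fenchelConj f p :=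
    le_iSup (fun x : E k => ((⟪p, x⟫ : ℝ) : EReal) - f x) x
  intro h
  rw [h, ← EReal.coe_toReal hx (hbot x), ← EReal.coe_sub, le_bot_iff] at h1
  exact EReal.coe_ne_bot _ h1

lemma strong_affMin {k : ℕ} {f : E k → EReal} {α : ℝ} (hproper : ∃ x, f x ≠ ⊤)
    (hbot : ∀ x, f x ≠ ⊥)
    (hs : StrongConvexOnE Set.univ α (fenchelConj f)) {p q : E k} {b c : ℝ}
    (hp : AffMin f p b) (hq : AffMin f q c) {t : ℝ} (ht : t ∈ Set.Icc (0 : ℝ) 1) :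
    AffMin f (t • p + (1 - t) • q)
      (t * b + (1 - t) * c - α * t * (1 - t) / 2 * ‖q - p‖ ^ 2) := by
  rw [← conj_le_iff hbot] at *
  have hpt : fenchelConj f p ≠ ⊤ := fun h => by simp [h] at hp
  have hqt : fenchelConj f q ≠ ⊤ := fun h => by simp [h] at hq
  have hpb := conj_ne_bot hproper hbot p
  have hqb := conj_ne_bot hproper hbot q
  refine (hs (Set.mem_univ p) hpt hpb (Set.mem_univ q) hqt hqb t ht).trans ?_
  rw [EReal.coe_le_coe_iff]
  have h1 : (fenchelConj f p).toReal ≤ b := by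
    rwa [← EReal.coe_le_coe_iff, EReal.coe_toReal hpt hpb]
  have h2 : (fenchelConj f q).toReal ≤ c := by
    rwa [← EReal.coe_le_coe_iff, EReal.coe_toReal hqt hqb]
  have h3 := mul_le_mul_of_nonneg_left h1 ht.1
  have h4 := mul_le_mul_of_nonneg_left h2 (sub_nonneg.2 ht.2)
  linarith

lemma dual_repr {k : ℕ} (L : E k × ℝ →L[ℝ] ℝ) :
    ∃ (q : E k) (m : ℝ), ∀ x r, L (x, r) = ⟪q, x⟫ + m * r := by
  refine ⟨(InnerProductSpace.toDual ℝ (E k)).symm (L.comp (.inl ℝ (E k) ℝ)), L (0, 1), ?_⟩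
  intro x r
  rw [InnerProductSpace.toDual_symm_apply]
  have : (x, r) = (x, (0 : ℝ)) + r • ((0 : E k), (1 : ℝ)) := by simp
  rw [this, map_add, map_smul]
  simp [mul_comm]

lemma epi_sep {k : ℕ} {f : E k → EReal} (hbot : ∀ x, f x ≠ ⊥)
    (hconv : EConvexOn f) (hlsc : LowerSemicontinuous f) (u : E k) (c : ℝ)
    (hc : (c : EReal) < f u) :
    ∃ (q : E k) (m s : ℝ), ⟪q, u⟫ + m * c < s ∧
      ∀ x (r : ℝ), f x ≤ (r : EReal) → s < ⟪q, x⟫ + m * r := by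
  let A : Set (E k × ℝ) := {z | f z.1 ≤ (z.2 : EReal)}
  have hA : IsClosed A := by
    have := lowerSemicontinuous_iff_isClosed_epigraph.1 hlsc
    exact this.preimage (f := fun z : E k × ℝ => (z.1, (z.2 : EReal)))
      (continuous_fst.prodMk (continuous_coe_real_ereal.comp continuous_snd))
  have hAc : Convex ℝ A := by
    rw [convex_iff_forall_pos]
    rintro ⟨x, r⟩ hx ⟨y, r'⟩ hy a b ha hb hab
    change f x ≤ (r : EReal) at hx
    change f y ≤ (r' : EReal) at hy
    change f (a • x + b • y) ≤ ((a * r + b * r' : ℝ) : EReal)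
    obtain rfl : b = 1 - a := by linarith
    refine (hconv x y a ⟨ha, by linarith⟩).trans ?_
    have hxt : f x ≠ ⊤ := fun h => by simp [h] at hx
    have hyt : f y ≠ ⊤ := fun h => by simp [h] at hy
    rw [← EReal.coe_toReal hxt (hbot x)] at hx ⊢
    rw [← EReal.coe_toReal hyt (hbot y)] at hy ⊢
    rw [EReal.coe_le_coe_iff] at hx hy
    rw [← EReal.coe_mul, ← EReal.coe_mul, ← EReal.coe_add, EReal.coe_le_coe_iff]
    have h3 := mul_le_mul_of_nonneg_left hx ha.le
    have h4 := mul_le_mul_of_nonneg_left hy hb.le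
    linarith
  have hn : (u, c) ∉ A := fun h => absurd hc (not_lt.2 h)
  obtain ⟨L, s, h1, h2⟩ := geometric_hahn_banach_point_closed hAc hA hn
  obtain ⟨q, m, hL⟩ := dual_repr L
  refine ⟨q, m, s, by rw [← hL]; exact h1, fun x r hr => ?_⟩
  rw [← hL]
  exact h2 (x, r) hr

lemma fenchel_moreau {k : ℕ} {f : E k → EReal} (hbot : ∀ x, f x ≠ ⊥)
    (hproper : ∃ x, f x ≠ ⊤)
    (hconv : EConvexOn f) (hlsc : LowerSemicontinuous f) (u : E k) (c : ℝ)
    (hc : (c : EReal) < f u) :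
    ∃ p b, AffMin f p b ∧ c < ⟪p, u⟫ - b := by
  have pos : ∀ (v : E k) (c q m s), 0 < m → ⟪q, v⟫ + m * c < s →
      (∀ x (r : ℝ), f x ≤ (r : EReal) → s < ⟪q, x⟫ + m * r) →
      ∃ p b, AffMin f p b ∧ c < ⟪p, v⟫ - b := by
    intro v c q m s hm h1 h2
    refine ⟨(-m⁻¹) • q, -m⁻¹ * s, fun x r hr => ?_, ?_⟩
    · have := h2 x r hr
      rw [real_inner_smul_left]
      have h3 : m⁻¹ * s ≤ m⁻¹ * (⟪q, x⟫ + m * r) :=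
        mul_le_mul_of_nonneg_left this.le (inv_pos.2 hm).le
      rw [mul_add, inv_mul_cancel_left₀ hm.ne'] at h3
      linarith
    · rw [real_inner_smul_left]
      have h3 : m⁻¹ * (⟪q, v⟫ + m * c) < m⁻¹ * s :=
        mul_lt_mul_of_pos_left h1 (inv_pos.2 hm)
      rw [mul_add, inv_mul_cancel_left₀ hm.ne'] at h3
      linarith
  obtain ⟨x0, hx0⟩ := hproper
  obtain ⟨r0, hr0⟩ : ∃ r0 : ℝ, f x0 = (r0 : EReal) :=
    ⟨_, (EReal.coe_toReal hx0 (hbot x0)).symm⟩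
  obtain ⟨q, m, s, h1, h2⟩ := epi_sep hbot hconv hlsc u c hc
  have hm : 0 ≤ m := by
    by_contra! hneg
    have h3 := h2 x0 (max r0 ((s - ⟪q, x0⟫) / m)) (by
      rw [hr0, EReal.coe_le_coe_iff]; exact le_max_left _ _)
    have h4 := mul_le_mul_of_nonpos_left (le_max_right r0 ((s - ⟪q, x0⟫) / m)) hneg.le
    rw [mul_div_cancel₀ _ hneg.ne] at h4
    linarith
  rcases hm.lt_or_eq with hm | hm
  · exact pos u c q m s hm h1 h2
  · subst hm
    obtain ⟨q0, m0, s0, h3, h4⟩ := epi_sep hbot hconv hlsc x0 (r0 - 1) (by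
      rw [hr0, EReal.coe_lt_coe_iff]; linarith)
    have h5 := h4 x0 r0 hr0.le
    obtain ⟨p0, b0, hp0, -⟩ := pos x0 _ q0 m0 s0 (by nlinarith) h3 h4
    have hd : 0 < s - ⟪q, u⟫ := by linarith
    obtain ⟨K, hK⟩ : ∃ K : ℝ, K = (|c - (⟪p0, u⟫ - b0)| + 1) / (s - ⟪q, u⟫) := ⟨_, rfl⟩
    have hK0 : 0 ≤ K := by rw [hK]; positivity
    refine ⟨p0 - K • q, b0 - K * s, fun x r hr => ?_, ?_⟩
    · have h6 := hp0 x r hr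
      have h7 := h2 x r hr
      rw [inner_sub_left, real_inner_smul_left]
      nlinarith
    · rw [inner_sub_left, real_inner_smul_left]
      have h6 : K * (s - ⟪q, u⟫) = |c - (⟪p0, u⟫ - b0)| + 1 := by
        rw [hK]; field_simp
      have := le_abs_self (c - (⟪p0, u⟫ - b0))
      linarith

lemma sq_combo {k : ℕ} (a b : E k) (t : ℝ) :
    t * ‖a‖ ^ 2 + (1 - t) * ‖b‖ ^ 2 =
      ‖t • a + (1 - t) • b‖ ^ 2 + t * (1 - t) * ‖a - b‖ ^ 2 := by
  simp only [← real_inner_self_eq_norm_sq, inner_add_left, inner_add_right, inner_sub_left,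
    inner_sub_right, real_inner_smul_left, real_inner_smul_right, real_inner_comm a b]
  ring

lemma smooth_ineq {k : ℕ} {f : E k → EReal} {α : ℝ} (hα : 0 < α) (hproper : ∃ x, f x ≠ ⊤)
    (hbot : ∀ x, f x ≠ ⊥) (hconv : EConvexOn f) (hlsc : LowerSemicontinuous f)
    (hs : StrongConvexOnE Set.univ α (fenchelConj f)) (u v : E k) (t : ℝ)
    (ht : t ∈ Set.Icc (0 : ℝ) 1) (W c d : ℝ) (hW : f (t • u + (1 - t) • v) ≤ (W : EReal))
    (hc : (c : EReal) < f u) (hd : (d : EReal) < f v) :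
    t * c + (1 - t) * d ≤ W + t * (1 - t) * ((1 / α) / 2 * ‖u - v‖ ^ 2) := by
  obtain ⟨p, b, hp, hpc⟩ := fenchel_moreau hbot hproper hconv hlsc u c hc
  obtain ⟨q, e, hq, hqd⟩ := fenchel_moreau hbot hproper hconv hlsc v d hd
  have h := strong_affMin hproper hbot hs hp hq ht _ W hW
  have h3 := mul_le_mul_of_nonneg_left hpc.le ht.1
  have h4 := mul_le_mul_of_nonneg_left hqd.le (sub_nonneg.2 ht.2)
  have h5 : ⟪p - q, u - v⟫ ≤ α / 2 * ‖q - p‖ ^ 2 + (1 / α) / 2 * ‖u - v‖ ^ 2 := by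
    have h6 : 0 ≤ ‖α • (p - q) - (u - v)‖ ^ 2 := by positivity
    rw [norm_sub_sq_real, real_inner_smul_left, norm_smul, Real.norm_eq_abs, mul_pow, sq_abs] at h6
    rw [norm_sub_rev q p]
    have h7 : 0 ≤ (1 / α) / 2 * (α ^ 2 * ‖p - q‖ ^ 2 - 2 * (α * ⟪p - q, u - v⟫) + ‖u - v‖ ^ 2) :=
      mul_nonneg (by positivity) h6
    have h8 : (1 / α) / 2 * (α ^ 2 * ‖p - q‖ ^ 2 - 2 * (α * ⟪p - q, u - v⟫) + ‖u - v‖ ^ 2)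
      = α / 2 * ‖p - q‖ ^ 2 + (1 / α) / 2 * ‖u - v‖ ^ 2 - ⟪p - q, u - v⟫ := by
      field_simp
      ring
    linarith
  have h9 := mul_le_mul_of_nonneg_left h5 (mul_nonneg ht.1 (sub_nonneg.2 ht.2))
  simp only [inner_add_left, inner_add_right, inner_sub_left,
    inner_sub_right, real_inner_smul_left, real_inner_smul_right] at h h9
  nlinarith

lemma finite_of_strong {k : ℕ} {f : E k → EReal} {α : ℝ} (hα : 0 < α) (hproper : ∃ x, f x ≠ ⊤)
    (hbot : ∀ x, f x ≠ ⊥) (hconv : EConvexOn f) (hlsc : LowerSemicontinuous f)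
    (hs : StrongConvexOnE Set.univ α (fenchelConj f)) (u : E k) : f u ≠ ⊤ := by
  intro hu
  obtain ⟨w, hw⟩ := id hproper
  obtain ⟨W, hW⟩ : ∃ r0 : ℝ, f w = (r0 : EReal) := ⟨_, (EReal.coe_toReal hw (hbot w)).symm⟩
  obtain ⟨d, -, hd⟩ := EReal.lt_iff_exists_real_btwn.1 (bot_lt_iff_ne_bot.2 (hbot ((2 : ℝ) • w - u)))
  have hz : (1 / 2 : ℝ) • u + (1 - 1 / 2 : ℝ) • ((2 : ℝ) • w - u) = w := by
    module
  set v := (2 : ℝ) • w - u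
  have h := smooth_ineq hα hproper hbot hconv hlsc hs u v (1 / 2) (by constructor <;> norm_num) W
    (2 * (W + (1 / 2) * (1 - 1 / 2) * ((1 / α) / 2 * ‖u - v‖ ^ 2) - (1 - 1 / 2) * d + 1)) d
    (by rw [hz, hW]) (by rw [hu]; exact EReal.coe_lt_top _) hd
  linarith

lemma exists_subgrad {k : ℕ} {g : E k → ℝ} (hg : ConvexOn ℝ Set.univ g) (x : E k) :
    ∃ s : E k, ∀ y, g x + ⟪s, y - x⟫ ≤ g y := by
  have hcont : Continuous g := by
    rw [← continuousOn_univ]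
    exact hg.continuousOn isOpen_univ
  have hopen : IsOpen {z : E k × ℝ | z.1 ∈ Set.univ ∧ g z.1 < z.2} := by
    simp only [Set.mem_univ, true_and]
    exact isOpen_lt (hcont.comp continuous_fst) continuous_snd
  obtain ⟨L, hL⟩ := geometric_hahn_banach_point_open hg.convex_strict_epigraph hopen
    (x := (x, g x)) (by simp)
  obtain ⟨q, m, hr⟩ := dual_repr L
  have h : ∀ y r, g y < r → ⟪q, x⟫ + m * g x < ⟪q, y⟫ + m * r := by
    intro y r hyr
    rw [← hr, ← hr]
    exact hL (y, r) ⟨Set.mem_univ _, hyr⟩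
  have hm : 0 < m := by
    have := h x (g x + 1) (by linarith)
    linarith
  refine ⟨(-m⁻¹) • q, fun y => ?_⟩
  refine le_of_forall_gt_imp_ge_of_dense fun r hyr => ?_
  have h1 := mul_lt_mul_of_pos_left (h y r hyr) (inv_pos.2 hm)
  rw [mul_add, inv_mul_cancel_left₀ hm.ne', mul_add, inv_mul_cancel_left₀ hm.ne'] at h1
  rw [real_inner_smul_left, inner_sub_right]
  linarith

lemma hasGradient_of_bound {k : ℕ} {g : E k → ℝ} {x s : E k} {L : ℝ} (hL : 0 < L)
    (h1 : ∀ y, g x + ⟪s, y - x⟫ ≤ g y)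
    (h2 : ∀ y, g y ≤ g x + ⟪s, y - x⟫ + L / 2 * ‖y - x‖ ^ 2) : HasGradientAt g s x := by
  rw [hasGradientAt_iff_isLittleO, Asymptotics.isLittleO_iff]
  intro c hc
  filter_upwards [Metric.ball_mem_nhds x (show 0 < 2 * c / L by positivity)] with y hy
  rw [Metric.mem_ball, dist_eq_norm, lt_div_iff₀ hL] at hy
  rw [Real.norm_eq_abs, abs_of_nonneg (by linarith [h1 y])]
  have := h2 y
  have := norm_nonneg (y - x)
  nlinarith

lemma forward {k : ℕ} {g : E k → ℝ} {L : ℝ} (hL : 0 < L) (hg : ConvexOn ℝ Set.univ g)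
    (hsm : ∀ u v : E k, ∀ t ∈ Set.Icc (0 : ℝ) 1, t * g u + (1 - t) * g v ≤
      g (t • u + (1 - t) • v) + t * (1 - t) * (L / 2 * ‖u - v‖ ^ 2)) :
    Differentiable ℝ g ∧ LipschitzWith (Real.toNNReal L) (fun x => gradient g x) := by
  have hk : ConvexOn ℝ Set.univ (fun x => L / 2 * ‖x‖ ^ 2 - g x) := by
    refine ⟨convex_univ, ?_⟩
    intro u _ v _ a b ha hb hab
    obtain rfl : b = 1 - a := by linarith
    have h1 := hsm u v a ⟨ha, by linarith⟩
    have h2 := sq_combo u v a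
    simp only [smul_eq_mul]
    linear_combination h1 + L / 2 * h2.symm.le
  have key : ∀ x, ∃ s : E k, (∀ y, g x + ⟪s, y - x⟫ ≤ g y) ∧
      ∀ y, g y ≤ g x + ⟪s, y - x⟫ + L / 2 * ‖y - x‖ ^ 2 := by
    intro x
    obtain ⟨s, hs⟩ := exists_subgrad hg x
    obtain ⟨r, hr⟩ := exists_subgrad hk x
    have hr' : ∀ y, g y ≤ g x + ⟪L • x - r, y - x⟫ + L / 2 * ‖y - x‖ ^ 2 := by
      intro y
      have h1 := hr y
      have h2 : ‖y‖ ^ 2 = ‖x‖ ^ 2 + 2 * ⟪x, y - x⟫ + ‖y - x‖ ^ 2 := by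
        rw [← norm_add_sq_real]; simp
      simp only [h2] at h1
      rw [inner_sub_left, real_inner_smul_left]
      linarith
    have hd : s = L • x - r := by
      obtain ⟨s', hs'⟩ : ∃ s', s' = L • x - r := ⟨_, rfl⟩
      rw [← hs'] at hr' ⊢
      have h1 := hs (x + L⁻¹ • (s - s'))
      have h2 := hr' (x + L⁻¹ • (s - s'))
      simp only [add_sub_cancel_left] at h1 h2
      rw [norm_smul, Real.norm_eq_abs, mul_pow, sq_abs] at h2
      have h3 : L⁻¹ * ‖s - s'‖ ^ 2 ≤ L / 2 * (L⁻¹ ^ 2 * ‖s - s'‖ ^ 2) := by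
        rw [← real_inner_self_eq_norm_sq] at h2 ⊢
        rw [real_inner_smul_right] at h1 h2
        nth_rw 1 [inner_sub_left]
        linarith
      have h4 : L / 2 * (L⁻¹ ^ 2 * ‖s - s'‖ ^ 2) = L⁻¹ * ‖s - s'‖ ^ 2 / 2 := by
        field_simp
      have h5 : L⁻¹ * ‖s - s'‖ ^ 2 ≤ 0 := by linarith
      have h6 : ‖s - s'‖ ^ 2 ≤ 0 := by
        by_contra! hh
        have := mul_pos (inv_pos.2 hL) hh
        linarith
      have h7 : ‖s - s'‖ = 0 := by
        have := sq_nonneg ‖s - s'‖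
        exact pow_eq_zero_iff (two_ne_zero) |>.1 (le_antisymm h6 this)
      exact sub_eq_zero.1 (norm_eq_zero.1 h7)
    exact ⟨s, hs, hd ▸ hr'⟩
  choose s h1 h2 using key
  have hgrad : ∀ x, HasGradientAt g (s x) x := fun x => hasGradient_of_bound hL (h1 x) (h2 x)
  refine ⟨fun x => (hgrad x).differentiableAt, ?_⟩
  have he : (fun x => gradient g x) = s := funext fun x => (hgrad x).gradient
  rw [he]
  have hco : ∀ x y, L⁻¹ / 2 * ‖s x - s y‖ ^ 2 ≤ g y - g x - ⟪s x, y - x⟫ := by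
    intro x y
    have e1 := h1 x (y + L⁻¹ • (s x - s y))
    have e2 := h2 y (y + L⁻¹ • (s x - s y))
    rw [add_sub_right_comm, inner_add_right] at e1
    simp only [add_sub_cancel_left] at e2
    rw [norm_smul, Real.norm_eq_abs, mul_pow, sq_abs] at e2
    have e3 : L / 2 * (L⁻¹ ^ 2 * ‖s x - s y‖ ^ 2) = L⁻¹ * ‖s x - s y‖ ^ 2 / 2 := by
      field_simp
    have e4 : ⟪s x, L⁻¹ • (s x - s y)⟫ - ⟪s y, L⁻¹ • (s x - s y)⟫ = L⁻¹ * ‖s x - s y‖ ^ 2 := by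
      rw [← inner_sub_left, real_inner_smul_right, real_inner_self_eq_norm_sq]
    linarith
  refine LipschitzWith.of_dist_le_mul fun x y => ?_
  rw [dist_eq_norm, dist_eq_norm, Real.coe_toNNReal _ hL.le]
  have a1 := hco x y
  have a2 := hco y x
  rw [norm_sub_rev (s y)] at a2
  have a3 : L⁻¹ * ‖s x - s y‖ ^ 2 ≤ ⟪s x - s y, x - y⟫ := by
    rw [← neg_sub y x, inner_neg_right, inner_sub_left]
    rw [← neg_sub y x, inner_neg_right] at a2
    linarith
  have a4 := a3.trans (real_inner_le_norm _ _)
  rw [inv_mul_le_iff₀ hL] at a4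
  rcases (norm_nonneg (s x - s y)).lt_or_eq with h | h
  · refine le_of_mul_le_mul_left ?_ h
    linarith
  · rw [← h]; positivity

lemma descent {k : ℕ} {g : E k → ℝ} {L : ℝ} (hL : 0 < L) (hd : Differentiable ℝ g)
    (hl : LipschitzWith (Real.toNNReal L) (fun x => gradient g x)) (x y : E k) :
    g y ≤ g x + ⟪gradient g x, y - x⟫ + L / 2 * ‖y - x‖ ^ 2 := by
  obtain ⟨d, rfl⟩ : ∃ d, y = x + d := ⟨y - x, by simp⟩
  rw [add_sub_cancel_left]
  let φ : ℝ → ℝ := fun t => g (x + t • d) - t * ⟪gradient g x, d⟫ - L / 2 * t ^ 2 * ‖d‖ ^ 2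
  have hφ : ∀ t, HasDerivAt φ
      (⟪gradient g (x + t • d), d⟫ - ⟪gradient g x, d⟫ - L * t * ‖d‖ ^ 2) t := by
    intro t
    have e1 : HasDerivAt (fun t : ℝ => x + t • d) d t := by
      simpa using ((hasDerivAt_id t).smul_const d).const_add x
    have e2 := (hd (x + t • d)).hasGradientAt.hasFDerivAt.comp_hasDerivAt t e1
    rw [InnerProductSpace.toDual_apply_apply] at e2
    have e3 := (hasDerivAt_id t).mul_const ⟪gradient g x, d⟫
    have e4 := ((hasDerivAt_pow 2 t).const_mul (L / 2)).mul_const (‖d‖ ^ 2)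
    refine ((e2.sub e3).sub e4).congr_deriv ?_
    push_cast
    ring
  have hanti : AntitoneOn φ (Set.Icc 0 1) := by
    refine antitoneOn_of_deriv_nonpos (convex_Icc 0 1)
      (fun t _ => (hφ t).continuousAt.continuousWithinAt)
      (fun t _ => (hφ t).differentiableAt.differentiableWithinAt) ?_
    intro t ht
    rw [interior_Icc] at ht
    rw [(hφ t).deriv, ← inner_sub_left]
    have e1 := real_inner_le_norm (gradient g (x + t • d) - gradient g x) d
    have e2 := hl.dist_le_mul (x + t • d) x
    rw [dist_eq_norm, dist_eq_norm, Real.coe_toNNReal _ hL.le, add_sub_cancel_left, norm_smul,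
      Real.norm_eq_abs, abs_of_pos ht.1] at e2
    have e3 := mul_le_mul_of_nonneg_right e2 (norm_nonneg d)
    nlinarith
  have := hanti (Set.left_mem_Icc.2 zero_le_one) (Set.right_mem_Icc.2 zero_le_one) zero_le_one
  simp only [φ, zero_smul, one_smul, add_zero] at this
  linarith

lemma backward {k : ℕ} {f : E k → EReal} {α : ℝ} (hα : 0 < α) (hbot : ∀ x, f x ≠ ⊥)
    {g : E k → ℝ} (hfg : ∀ x, f x = ((g x : ℝ) : EReal)) (hd : Differentiable ℝ g)
    (hl : LipschitzWith (Real.toNNReal (1 / α)) (fun x => gradient g x)) :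
    StrongConvexOnE Set.univ α (fenchelConj f) := by
  intro p _ hpt hpb q _ hqt hqb t ht
  rw [conj_le_iff hbot]
  have key : ∀ p : E k, ∀ b : ℝ, fenchelConj f p ≤ (b : EReal) → ∀ x,
      ⟪p, x⟫ - g x + α / 2 * ‖p - gradient g x‖ ^ 2 ≤ b := by
    intro p b hp x
    rw [conj_le_iff hbot] at hp
    have h1 := hp (x + α • (p - gradient g x)) _ (hfg _).le
    have h2 := descent (by positivity) hd hl x (x + α • (p - gradient g x))
    rw [add_sub_cancel_left, norm_smul, Real.norm_eq_abs, mul_pow, sq_abs] at h2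
    rw [inner_add_right] at h1
    have h3 : 1 / α / 2 * (α ^ 2 * ‖p - gradient g x‖ ^ 2) = α / 2 * ‖p - gradient g x‖ ^ 2 := by
      field_simp
    have h4 : ⟪p, α • (p - gradient g x)⟫ - ⟪gradient g x, α • (p - gradient g x)⟫ =
        α * ‖p - gradient g x‖ ^ 2 := by
      rw [← inner_sub_left, real_inner_smul_right, real_inner_self_eq_norm_sq]
    linarith
  intro x r hr
  rw [hfg, EReal.coe_le_coe_iff] at hr
  have h1 := key p _ (EReal.coe_toReal hpt hpb).ge x
  have h2 := key q _ (EReal.coe_toReal hqt hqb).ge x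
  have h3 := mul_le_mul_of_nonneg_left h1 ht.1
  have h4 := mul_le_mul_of_nonneg_left h2 (sub_nonneg.2 ht.2)
  have h5 := sq_combo (p - gradient g x) (q - gradient g x) t
  rw [sub_sub_sub_cancel_right, norm_sub_rev p q] at h5
  have h6 : 0 ≤ α / 2 * ‖t • (p - gradient g x) + (1 - t) • (q - gradient g x)‖ ^ 2 := by
    positivity
  rw [inner_add_left, real_inner_smul_left, real_inner_smul_left]
  linear_combination h3 + h4 + h6 + hr - α / 2 * h5

/-- Let `f : ℝ^n → ℝ ∪ {+∞}` be proper convex lower semicontinuous and `α > 0`. Then `f*` is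
strongly convex with constant `α` w.r.t. `‖·‖₂` iff `f` is (finite and) differentiable on `ℝ^n`
with `∇f` Lipschitz continuous with constant `1/α` w.r.t. `‖·‖₂`. -/
theorem conjugate_strongly_convex_iff_gradient_lipschitz
    {n : ℕ} (f : E n → EReal) (α : ℝ) (hα : 0 < α)
    (hbot : ∀ x, f x ≠ ⊥) (hproper : ∃ x, f x ≠ ⊤)
    (hconv : EConvexOn f) (hlsc : LowerSemicontinuous f) :
    StrongConvexOnE Set.univ α (fenchelConj f) ↔
      ∃ g : E n → ℝ, (∀ x, f x = ((g x : ℝ) : EReal)) ∧ Differentiable ℝ g ∧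
        LipschitzWith (Real.toNNReal (1 / α)) (fun x => gradient g x) := by

  constructor
  · intro hs
    have hfin := finite_of_strong hα hproper hbot hconv hlsc hs
    have hfg : ∀ x, f x = (((f x).toReal : ℝ) : EReal) := fun x =>
      (EReal.coe_toReal (hfin x) (hbot x)).symm
    obtain ⟨g, hg⟩ : ∃ g : E n → ℝ, g = fun x => (f x).toReal := ⟨_, rfl⟩
    have hfg : ∀ x, f x = ((g x : ℝ) : EReal) := fun x => by rw [hg]; exact hfg x
    refine ⟨g, hfg, forward (by positivity) ?_ ?_⟩
    · rw [convexOn_iff_forall_pos]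
      refine ⟨convex_univ, fun x _ y _ a b ha hb hab => ?_⟩
      obtain rfl : b = 1 - a := by linarith
      have := hconv x y a ⟨ha, by linarith⟩
      simp only [hfg] at this
      rw [← EReal.coe_mul, ← EReal.coe_mul, ← EReal.coe_add, EReal.coe_le_coe_iff] at this
      simpa using this
    · intro u v t ht
      refine le_of_forall_pos_le_add fun ε hε => ?_
      have := smooth_ineq hα hproper hbot hconv hlsc hs u v t ht (g (t • u + (1 - t) • v))
        (g u - ε) (g v - ε) (hfg _).le (by rw [hfg, EReal.coe_lt_coe_iff]; linarith)
        (by rw [hfg, EReal.coe_lt_coe_iff]; linarith)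
      linarith
  · rintro ⟨g, hfg, hd, hl⟩
    exact backward hα hbot hfg hd hl
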